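/- Under the setting of the proximal-Newton scheme for F := f + g with f standard self-concordant and g proper, lower semicontinuous, convex, let the full-step iterates be x^{k+1} := x^k + d^k, where d^k := P^g_{∇²f(x^k)}(∇²f(x^k)x^k − ∇f(x^k)) − x^k and λ_k := ‖d^k‖_{x^k}, with each ∇²f(x^k) positive definite, and assume the unique minimizer x* of F satisfies ∇²f(x*) ≻ 0. If λ₀ ≤ σ̄ := (5 − √17)/4, then λ_{k+1} ≤ λ_k²/(1 − 4λ_k + 2λ_k²) for all k, λ_{k+1} ≤ λ_k, and the sequence {λ_k} converges to 0 at a quadratic rate. -/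

import Mathlib

open Matrix Set Filter Topology

noncomputable section

variable {n : ℕ}

/-- Weighted (semi)norm induced by a matrix `H`: `‖z‖_H = √(zᵀ H z)`. -/
def mNorm (H : Matrix (Fin n) (Fin n) ℝ) (z : Fin n → ℝ) : ℝ :=
  Real.sqrt (z ⬝ᵥ H.mulVec z)

/-- Dual weighted norm, `‖z‖*_H = √(zᵀ H⁻¹ z)`. -/
def mDualNorm (H : Matrix (Fin n) (Fin n) ℝ) (z : Fin n → ℝ) : ℝ :=
  Real.sqrt (z ⬝ᵥ H⁻¹.mulVec z)

/-- A function `g : ℝⁿ → ℝ ∪ {+∞}` (modelled with values in `EReal`) is proper. -/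
def EProper (g : (Fin n → ℝ) → EReal) : Prop :=
  (∀ x, g x ≠ ⊥) ∧ ∃ x, g x ≠ ⊤

/-- Convexity of an `EReal`-valued function on `ℝⁿ`. -/
def EConvex (g : (Fin n → ℝ) → EReal) : Prop :=
  ∀ x y : Fin n → ℝ, ∀ a b : ℝ, 0 ≤ a → 0 ≤ b → a + b = 1 →
    g (a • x + b • y) ≤ (a : EReal) * g x + (b : EReal) * g y

/-- `v` is a subgradient of `g` at `x`. -/
def ESubgradAt (g : (Fin n → ℝ) → EReal) (v x : Fin n → ℝ) : Prop :=
  g x ≠ ⊤ ∧ ∀ y, g x + ((v ⬝ᵥ (y - x) : ℝ) : EReal) ≤ g y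

/-- Objective of the proximal subproblem `g(x) + ½ xᵀHx − uᵀx`. -/
def proxObj (H : Matrix (Fin n) (Fin n) ℝ) (g : (Fin n → ℝ) → EReal)
    (u x : Fin n → ℝ) : EReal :=
  g x + ((1 / 2 * (x ⬝ᵥ H.mulVec x) - u ⬝ᵥ x : ℝ) : EReal)

/-- `p` solves the proximal subproblem, i.e. `p = P^g_H(u)`. -/
def IsProxPt (H : Matrix (Fin n) (Fin n) ℝ) (g : (Fin n → ℝ) → EReal)
    (u p : Fin n → ℝ) : Prop :=
  ∀ x, proxObj H g u p ≤ proxObj H g u x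

/-- The continuous linear map `y ↦ vᵀy`. -/
def dotCLM (v : Fin n → ℝ) : (Fin n → ℝ) →L[ℝ] ℝ :=
  LinearMap.toContinuousLinearMap
    { toFun := fun y => v ⬝ᵥ y
      map_add' := fun a b => dotProduct_add v a b
      map_smul' := fun c a => by simp }

/-- `f` is standard self-concordant on the open convex set `D`. -/
def StdSelfConcordantOn (D : Set (Fin n → ℝ)) (f : (Fin n → ℝ) → ℝ) : Prop :=
  IsOpen D ∧ Convex ℝ D ∧ ConvexOn ℝ D f ∧ ContDiffOn ℝ 3 f D ∧
    ∀ x ∈ D, ∀ v : Fin n → ℝ, ∀ t : ℝ, x + t • v ∈ D →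
      |iteratedDeriv 3 (fun s : ℝ => f (x + s • v)) t| ≤
        2 * iteratedDeriv 2 (fun s : ℝ => f (x + s • v)) t ^ ((3 : ℝ) / 2)

open scoped Classical in
/-- The extended objective `F = f + g`, equal to `+∞` outside `dom f`. -/
def Fext (D : Set (Fin n → ℝ)) (f : (Fin n → ℝ) → ℝ) (g : (Fin n → ℝ) → EReal)
    (x : Fin n → ℝ) : EReal :=
  if x ∈ D then (f x : EReal) + g x else ⊤

def omega (t : ℝ) : ℝ := t - Real.log (1 + t)

def omegaStar (t : ℝ) : ℝ := -t - Real.log (1 - t)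

section Trilinear

/-- A three-node quadrature identity on binary cubic forms: `A cos 3β + b sin 3β` is a combination
of the values of the form at the angles `β`, `β + π/3` and `β + 2π/3`. -/
theorem cubic_form_quadrature (A b c g C S r : ℝ) (hr : r ^ 2 = 3) :
    9 * ((A * (C ^ 3 - 3 * C * S ^ 2) + b * (3 * C ^ 2 * S - S ^ 3)) * (C ^ 2 + S ^ 2) ^ 2) =
      let p : ℝ → ℝ → ℝ := fun X Y =>
        A * X ^ 3 + 3 * b * X ^ 2 * Y + 3 * c * X * Y ^ 2 + g * Y ^ 3
      let C₁ := C / 2 - r * S / 2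
      let S₁ := S / 2 + r * C / 2
      let C₂ := -C / 2 - r * S / 2
      let S₂ := -S / 2 + r * C / 2
      (3 * C ^ 2 - S ^ 2) ^ 2 * p C S - (3 * C₁ ^ 2 - S₁ ^ 2) ^ 2 * p C₁ S₁
        + (3 * C₂ ^ 2 - S₂ ^ 2) ^ 2 * p C₂ S₂ := by
  have h3 : r ^ 3 = 3 * r := by rw [pow_succ, hr]
  have h4 : r ^ 4 = 9 := by linear_combination (r ^ 2 + 3) * hr
  have h6 : r ^ 6 = 27 := by linear_combination (r ^ 4 + 3 * r ^ 2 + 9) * hr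
  ring_nf
  simp only [hr, h4, h6]
  ring

/-- The sharp Bernstein inequality for binary cubic forms. -/
theorem cubic_form_polar_le {A b c g M : ℝ}
    (hp : ∀ X Y : ℝ, X ^ 2 + Y ^ 2 = 1 →
      |A * X ^ 3 + 3 * b * X ^ 2 * Y + 3 * c * X * Y ^ 2 + g * Y ^ 3| ≤ M)
    {s : ℝ} (hs : s ^ 2 ≤ 1) : A * s + b * √(1 - s ^ 2) ≤ M := by
  set β := Real.arccos s / 3 with hβ
  have hs' := abs_le.1 ((sq_le_one_iff_abs_le_one s).1 hs)
  have h3β : 3 * β = Real.arccos s := by rw [hβ]; ring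
  have hC : s = 4 * Real.cos β ^ 3 - 3 * Real.cos β := by
    rw [← Real.cos_three_mul, h3β, Real.cos_arccos hs'.1 hs'.2]
  have hS : √(1 - s ^ 2) = 3 * Real.sin β - 4 * Real.sin β ^ 3 := by
    rw [← Real.sin_three_mul, h3β, Real.sin_arccos]
  rw [hS]
  have hCS := Real.cos_sq_add_sin_sq β
  set C := Real.cos β
  set S := Real.sin β
  obtain ⟨r, hr⟩ : ∃ r : ℝ, r ^ 2 = 3 := ⟨√3, Real.sq_sqrt (by norm_num)⟩
  have hq := cubic_form_quadrature A b c g C S r hr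
  have h0 := abs_le.1 (hp C S hCS)
  have h1 := abs_le.1 (hp (C / 2 - r * S / 2) (S / 2 + r * C / 2)
    (by linear_combination (1 / 4 + r ^ 2 / 4) * hCS + hr / 4))
  have h2 := abs_le.1 (hp (-C / 2 - r * S / 2) (-S / 2 + r * C / 2)
    (by linear_combination (1 / 4 + r ^ 2 / 4) * hCS + hr / 4))
  have hsum : (3 * C ^ 2 - S ^ 2) ^ 2
      + (3 * (C / 2 - r * S / 2) ^ 2 - (S / 2 + r * C / 2) ^ 2) ^ 2
      + (3 * (-C / 2 - r * S / 2) ^ 2 - (-S / 2 + r * C / 2) ^ 2) ^ 2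
      = 9 * (C ^ 2 + S ^ 2) ^ 2 := by
    have h4 : r ^ 4 = 9 := by linear_combination (r ^ 2 + 3) * hr
    ring_nf
    simp only [hr, h4]
    ring
  have hlhs : A * s + b * (3 * S - 4 * S ^ 3)
      = A * (C ^ 3 - 3 * C * S ^ 2) + b * (3 * C ^ 2 * S - S ^ 3) := by
    rw [hC]
    linear_combination (3 * A * C - 3 * b * S) * hCS
  rw [hCS] at hq hsum
  have e0 := mul_le_mul_of_nonneg_left h0.2 (sq_nonneg (3 * C ^ 2 - S ^ 2))
  have e1 := mul_le_mul_of_nonneg_left h1.1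
    (sq_nonneg (3 * (C / 2 - r * S / 2) ^ 2 - (S / 2 + r * C / 2) ^ 2))
  have e2 := mul_le_mul_of_nonneg_left h2.2
    (sq_nonneg (3 * (-C / 2 - r * S / 2) ^ 2 - (-S / 2 + r * C / 2) ^ 2))
  have hM := congrArg (M * ·) hsum
  simp only at hM hq
  linarith

variable {E : Type*} [NormedAddCommGroup E] [NormedSpace ℝ E]

theorem trilinear_polar_le_of_orthogonal {B : E →L[ℝ] E →L[ℝ] ℝ} {T : E →L[ℝ] E →L[ℝ] E →L[ℝ] ℝ}
    {M : ℝ} (hB : ∀ u v, B u v = B v u) (hM : 0 ≤ M)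
    (hT1 : ∀ u v w, T u v w = T v u w) (hT2 : ∀ u v w, T u v w = T u w v)
    (hT : ∀ u, |T u u u| ≤ M * √(B u u) ^ 3)
    {d e : E} (hd : B d d ≤ 1) (he : B e e ≤ 1) (hde : B d e = 0) {s : ℝ} (hs : s ^ 2 ≤ 1) :
    T d d (s • d + √(1 - s ^ 2) • e) ≤ M := by
  have key : T d d (s • d + √(1 - s ^ 2) • e) = T d d d * s + T d d e * √(1 - s ^ 2) := by
    simp only [map_add, map_smul, smul_eq_mul]; ring
  rw [key]
  refine cubic_form_polar_le (c := T d e e) (g := T e e e) (fun X Y hXY => ?_) hs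
  have h := hT (X • d + Y • e)
  have hb : B (X • d + Y • e) (X • d + Y • e) ≤ 1 := by
    simp only [map_add, map_smul, smul_eq_mul, _root_.add_apply,
      _root_.smul_apply, hB e d, hde]
    nlinarith [mul_le_mul_of_nonneg_left hd (sq_nonneg X),
      mul_le_mul_of_nonneg_left he (sq_nonneg Y)]
  have ht : T (X • d + Y • e) (X • d + Y • e) (X • d + Y • e) =
      T d d d * X ^ 3 + 3 * T d d e * X ^ 2 * Y + 3 * T d e e * X * Y ^ 2 + T e e e * Y ^ 3 := by
    simp only [map_add, map_smul, smul_eq_mul, _root_.add_apply,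
      _root_.smul_apply]
    rw [hT1 e d d, hT2 d e d, hT2 e e d, hT1 e d e]
    ring
  rw [← ht]
  refine h.trans (mul_le_of_le_one_right hM (pow_le_one₀ (Real.sqrt_nonneg _) ?_))
  exact Real.sqrt_le_one.2 hb

/-- If the cubic form of a symmetric trilinear form is bounded by `M` in a Hilbertian seminorm,
then so is its polarization in one variable. -/
theorem trilinear_polar_le {B : E →L[ℝ] E →L[ℝ] ℝ} {T : E →L[ℝ] E →L[ℝ] E →L[ℝ] ℝ}
    {M : ℝ} (hB : ∀ u v, B u v = B v u) (hB0 : ∀ u, 0 ≤ B u u) (hM : 0 ≤ M)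
    (hT1 : ∀ u v w, T u v w = T v u w) (hT2 : ∀ u v w, T u v w = T u w v)
    (hT : ∀ u, |T u u u| ≤ M * √(B u u) ^ 3) (d w : E) :
    T d d w ≤ M * B d d * √(B w w) := by
  have horth {d e : E} := trilinear_polar_le_of_orthogonal (d := d) (e := e) hB hM hT1 hT2 hT
  have hquad (t : ℝ) : 0 ≤ B d d * (t * t) + 2 * B d w * t + B w w := by
    have := hB0 (t • d + w)
    simp only [map_add, map_smul, smul_eq_mul, _root_.add_apply,
      _root_.smul_apply, hB w d] at this
    linarith
  have hcs : B d w ^ 2 ≤ B d d * B w w := by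
    have := discrim_le_zero hquad
    rw [discrim] at this
    linarith
  suffices h : ∀ μ, √(B w w) < μ → T d d w ≤ M * B d d * μ from
    ge_of_tendsto (x := 𝓝[>] √(B w w)) (f := fun μ => M * B d d * μ)
      (((continuous_const.mul continuous_id).tendsto _).mono_left nhdsWithin_le_nhds)
      (eventually_nhdsWithin_of_forall h)
  intro μ hμ
  have hμ0 : 0 < μ := (Real.sqrt_nonneg _).trans_lt hμ
  have hwμ : B w w < μ ^ 2 := (Real.sqrt_lt' hμ0).1 hμ
  rcases (hB0 d).eq_or_lt with h0 | h0
  · rw [← h0, zero_mul] at hcs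
    have hdw : B d w = 0 := by nlinarith
    have hk (k : ℝ) : k ^ 2 * (T d d w / μ) ≤ M := by
      have := horth (d := k • d) (e := μ⁻¹ • w) (by simp [← h0])
        (by
          simp only [map_smul, smul_eq_mul, _root_.smul_apply]
          rw [← mul_assoc, ← sq, inv_pow, inv_mul_le_one₀ (by positivity)]
          exact hwμ.le)
        (by simp [hdw]) (s := 0) (by norm_num)
      simp only [map_smul, smul_eq_mul, _root_.smul_apply, zero_smul, zero_add, ne_eq,
        OfNat.ofNat_ne_zero, not_false_eq_true, zero_pow, sub_zero, Real.sqrt_one, one_smul] at this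
      calc _ = k * (k * (μ⁻¹ * T d d w)) := by ring
        _ ≤ M := by linarith
    rw [← h0, mul_zero, zero_mul]
    by_contra! hpos
    have := hk (√((M + 1) / (T d d w / μ)))
    rw [Real.sq_sqrt (by positivity), div_mul_cancel₀ _ (by positivity)] at this
    linarith
  · set a := √(B d d) with ha
    have ha0 : 0 < a := Real.sqrt_pos.2 h0
    have ha2 : a ^ 2 = B d d := Real.sq_sqrt h0.le
    set s := B d w / (a * μ) with hs
    have hs2 : s ^ 2 < 1 := by
      rw [hs, div_pow, div_lt_one (by positivity), mul_pow, ha2]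
      exact hcs.trans_lt (mul_lt_mul_of_pos_left hwμ h0)
    have hr0 : 0 < 1 - s ^ 2 := by linarith
    set r := √(1 - s ^ 2) with hr
    have hr1 : 0 < r := Real.sqrt_pos.2 hr0
    have hr2 : r ^ 2 = 1 - s ^ 2 := Real.sq_sqrt hr0.le
    have hsB : B d w = s * (a * μ) := by rw [hs]; field_simp
    have := horth (d := a⁻¹ • d) (e := r⁻¹ • (μ⁻¹ • w - s • a⁻¹ • d))
      (by
        simp only [map_smul, smul_eq_mul, _root_.smul_apply]
        rw [← ha2]; field_simp; exact le_refl _)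
      (by
        simp only [map_smul, map_sub, smul_eq_mul, _root_.smul_apply, _root_.sub_apply]
        rw [hB w d, hsB, ← ha2]
        have h1 : B w w / μ ^ 2 ≤ 1 := (div_le_one (by positivity)).2 hwμ.le
        have h2 : (B w w / μ ^ 2 - s ^ 2) / r ^ 2 ≤ 1 := by
          rw [div_le_one (by positivity), hr2]; linarith
        refine le_of_eq_of_le ?_ h2
        field_simp
        ring)
      (by
        simp only [map_smul, map_sub, smul_eq_mul, _root_.smul_apply]
        rw [hsB, ← ha2]; field_simp; ring)
      hs2.le
    rw [← hr, smul_inv_smul₀ hr1.ne', add_sub_cancel] at this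
    simp only [map_smul, smul_eq_mul, _root_.smul_apply] at this
    have h2 : T d d w = a ^ 2 * μ * (a⁻¹ * (a⁻¹ * (μ⁻¹ * T d d w))) := by field_simp
    rw [h2, ← ha2]
    nlinarith [mul_le_mul_of_nonneg_left this (by positivity : 0 ≤ a ^ 2 * μ)]

end Trilinear

section ScalarGrowth

theorem le_of_hasDerivAt_nonneg {h h' : ℝ → ℝ} {a b : ℝ} (hab : a ≤ b)
    (hd : ∀ t ∈ Icc a b, HasDerivAt h (h' t) t) (h0 : ∀ t ∈ Icc a b, 0 ≤ h' t) : h a ≤ h b :=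
  monotoneOn_of_deriv_nonneg (convex_Icc a b)
    (fun t ht => (hd t ht).continuousAt.continuousWithinAt)
    (fun t ht => (hd t (interior_subset ht)).differentiableAt.differentiableWithinAt)
    (fun t ht => (hd t (interior_subset ht)).deriv ▸ h0 t (interior_subset ht))
    (left_mem_Icc.2 hab) (right_mem_Icc.2 hab) hab

theorem sqrt_le_of_abs_deriv_le {h h' : ℝ → ℝ} {l : ℝ}
    (hd : ∀ t ∈ Icc (0 : ℝ) 1, HasDerivAt h (h' t) t)
    (hh : ∀ t ∈ Icc (0 : ℝ) 1, 0 ≤ h t) (hsc : ∀ t ∈ Icc (0 : ℝ) 1, |h' t| ≤ 2 * √(h t) ^ 3)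
    (hl : l = √(h 0)) (hl1 : l < 1) {t : ℝ} (ht : t ∈ Icc (0 : ℝ) 1) :
    √(h t) ≤ l / (1 - t * l) := by
  have hl0 : 0 ≤ l := hl ▸ Real.sqrt_nonneg _
  have hl2 : l ^ 2 = h 0 := hl ▸ Real.sq_sqrt (hh 0 (by simp))
  have htl : t * l < 1 := by nlinarith [ht.1, ht.2]
  suffices H : ∀ μ ∈ Ioo l 1, √(h t) ≤ μ / (1 - t * μ) by
    refine ge_of_tendsto (x := 𝓝[>] l) (f := fun μ => μ / (1 - t * μ)) ?_
      (eventually_of_mem (Ioo_mem_nhdsGT hl1) H)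
    have hc : ContinuousAt (fun μ : ℝ => μ / (1 - t * μ)) l := by
      apply ContinuousAt.div
      · fun_prop
      · fun_prop
      · linarith
    exact hc.tendsto.mono_left nhdsWithin_le_nhds
  rintro μ ⟨hμ, hμ1⟩
  have hμ0 : 0 < μ := hl0.trans_lt hμ
  have htμ : t * μ < 1 := by nlinarith [ht.1, ht.2]
  set ε := μ ^ 2 - l ^ 2 with hε
  have hε0 : 0 < ε := by nlinarith
  have hpos : ∀ s ∈ Icc (0 : ℝ) 1, 0 < h s + ε := fun s hs => by linarith [hh s hs]
  have hder : ∀ s ∈ Icc (0 : ℝ) t, HasDerivAt (fun s => (√(h s + ε))⁻¹ + s)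
      (-(h' s / (2 * √(h s + ε))) / √(h s + ε) ^ 2 + 1) s := fun s hs => by
    have hs' : s ∈ Icc (0 : ℝ) 1 := ⟨hs.1, hs.2.trans ht.2⟩
    exact ((((hd s hs').add_const ε).sqrt (hpos s hs').ne').inv
      (Real.sqrt_pos.2 (hpos s hs')).ne').add (hasDerivAt_id s)
  have hmono := le_of_hasDerivAt_nonneg ht.1 hder (fun s hs => by
    have hs' : s ∈ Icc (0 : ℝ) 1 := ⟨hs.1, hs.2.trans ht.2⟩
    have hu := Real.sqrt_pos.2 (hpos s hs')
    have h1 : √(h s) ^ 3 ≤ √(h s + ε) ^ 3 := by gcongr; linarith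
    have h2 : h' s / (2 * √(h s + ε) ^ 3) ≤ 1 := by
      rw [div_le_one (by positivity)]
      linarith [le_abs_self (h' s), hsc s hs']
    have h3 : -(h' s / (2 * √(h s + ε))) / √(h s + ε) ^ 2 = -(h' s / (2 * √(h s + ε) ^ 3)) := by
      field_simp
    linarith)
  have hμε : √(h 0 + ε) = μ := by
    rw [← hl2, hε, add_sub_cancel, Real.sqrt_sq hμ0.le]
  have hu := Real.sqrt_pos.2 (hpos t ht)
  have h1 : √(h t) ≤ √(h t + ε) := by gcongr; linarith
  refine h1.trans ?_
  simp only [hμε, add_zero] at hmono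
  have h2 : μ⁻¹ - t = (1 - t * μ) / μ := by field_simp
  have h3 : (1 - t * μ) / μ ≤ (√(h t + ε))⁻¹ := by linarith
  rw [← inv_div (1 - t * μ)]
  exact (le_inv_comm₀ (div_pos (by linarith) hμ0) hu).1 h3

theorem sqrt_le_mul_of_abs_deriv_le {p p' : ℝ → ℝ} {l : ℝ}
    (hd : ∀ t ∈ Icc (0 : ℝ) 1, HasDerivAt p (p' t) t)
    (hl0 : 0 ≤ l) (hl1 : l < 1)
    (hp' : ∀ t ∈ Icc (0 : ℝ) 1, -p' t ≤ 2 * p t * (l / (1 - t * l)))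
    {t : ℝ} (ht : t ∈ Icc (0 : ℝ) 1) :
    √(p t) ≤ √(p 1) * ((1 - t * l) / (1 - l)) := by
  have hpos : ∀ s ∈ Icc (0 : ℝ) 1, 0 < 1 - s * l := fun s hs => by nlinarith [hs.1, hs.2]
  have hmono := le_of_hasDerivAt_nonneg (h := fun s => p s * ((1 - s * l)⁻¹) ^ 2)
    (h' := fun s => p' s * ((1 - s * l)⁻¹) ^ 2
      + p s * (2 * (1 - s * l)⁻¹ * (l / (1 - s * l) ^ 2))) ht.2
    (fun s hs => by
      have hs' : s ∈ Icc (0 : ℝ) 1 := ⟨ht.1.trans hs.1, hs.2⟩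
      have h1 : HasDerivAt (fun s => 1 - s * l) (-l) s := by
        simpa using ((hasDerivAt_id s).mul_const l).const_sub 1
      have h2 := (h1.inv (hpos s hs').ne').pow 2
      have h3 := (hd s hs').mul h2
      refine HasDerivAt.congr_deriv h3 ?_
      simp)
    (fun s hs => by
      have hs' : s ∈ Icc (0 : ℝ) 1 := ⟨ht.1.trans hs.1, hs.2⟩
      have h1 := hp' s hs'
      have h2 := hpos s hs'
      have : p' s * ((1 - s * l)⁻¹) ^ 2 + p s * (2 * (1 - s * l)⁻¹ * (l / (1 - s * l) ^ 2))
        = (2 * p s * (l / (1 - s * l)) - -p' s) * ((1 - s * l)⁻¹) ^ 2 := by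
        field_simp; ring
      rw [this]
      exact mul_nonneg (by linarith) (by positivity))
  have h2 := hpos t ht
  have h3 : (0 : ℝ) < 1 - l := by linarith
  have h4 : p t ≤ p 1 * ((1 - t * l) / (1 - l)) ^ 2 := by
    have := mul_le_mul_of_nonneg_right hmono (sq_nonneg (1 - t * l))
    simp only [one_mul] at this
    calc p t = p t * (1 - t * l)⁻¹ ^ 2 * (1 - t * l) ^ 2 := by field_simp
      _ ≤ _ := this
      _ = _ := by field_simp
  calc √(p t) ≤ √(p 1 * ((1 - t * l) / (1 - l)) ^ 2) := Real.sqrt_le_sqrt h4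
    _ = _ := by rw [Real.sqrt_mul' _ (sq_nonneg _), Real.sqrt_sq (by positivity)]

theorem taylor_two_le {ψ ψ₁ ψ₂ : ℝ → ℝ} {C : ℝ}
    (hd : ∀ t ∈ Icc (0 : ℝ) 1, HasDerivAt ψ (ψ₁ t) t)
    (hd₁ : ∀ t ∈ Icc (0 : ℝ) 1, HasDerivAt ψ₁ (ψ₂ t) t)
    (hC : ∀ t ∈ Icc (0 : ℝ) 1, ψ₂ t ≤ 2 * C) : ψ 1 - ψ 0 - ψ₁ 0 ≤ C := by
  have h1 : ∀ t ∈ Icc (0 : ℝ) 1, ψ₁ t ≤ ψ₁ 0 + 2 * C * t := fun t ht => by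
    have := le_of_hasDerivAt_nonneg (h := fun s => 2 * C * s - ψ₁ s)
      (h' := fun s => 2 * C - ψ₂ s) ht.1
      (fun s hs => by
        have := ((hasDerivAt_id s).const_mul (2 * C)).sub (hd₁ s ⟨hs.1, hs.2.trans ht.2⟩)
        rwa [mul_one] at this)
      (fun s hs => by linarith [hC s ⟨hs.1, hs.2.trans ht.2⟩])
    simp only [mul_zero] at this
    linarith
  have := le_of_hasDerivAt_nonneg (h := fun s => C * s ^ 2 + ψ₁ 0 * s - ψ s)
    (h' := fun s => 2 * C * s + ψ₁ 0 - ψ₁ s) zero_le_one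
    (fun s hs => by
      have := (((hasDerivAt_pow 2 s).const_mul C).add
        ((hasDerivAt_id s).const_mul (ψ₁ 0))).sub (hd s hs)
      refine HasDerivAt.congr_deriv this ?_
      simp; ring)
    (fun s hs => by linarith [h1 s hs])
  norm_num at this
  linarith

end ScalarGrowth

section SelfConcordant

variable {E : Type*} [NormedAddCommGroup E] [NormedSpace ℝ E]

theorem hasDerivAt_comp_line {F : Type*} [NormedAddCommGroup F] [NormedSpace ℝ F] {f : E → F}
    {x v : E} {t : ℝ} (hf : DifferentiableAt ℝ f (x + t • v)) :
    HasDerivAt (fun s : ℝ => f (x + s • v)) (fderiv ℝ f (x + t • v) v) t := by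
  have h : HasDerivAt (fun s : ℝ => x + s • v) v t := by
    simpa using ((hasDerivAt_id t).smul_const v).const_add x
  exact hf.hasFDerivAt.comp_hasDerivAt t h

theorem HasDerivAt.clm_const_apply {F G : Type*} [NormedAddCommGroup F] [NormedSpace ℝ F]
    [NormedAddCommGroup G] [NormedSpace ℝ G] {c : ℝ → F →L[ℝ] G} {c' : F →L[ℝ] G} {t : ℝ}
    (hc : HasDerivAt c c' t) (v : F) : HasDerivAt (fun s => c s v) (c' v) t := by
  simpa using hc.clm_apply (hasDerivAt_const t v)

variable {D : Set E} {f : E → ℝ}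

theorem ContDiffOn.differentiableAt_fderiv_fderiv (hD : IsOpen D) (hf : ContDiffOn ℝ 3 f D) {y : E}
    (hy : y ∈ D) : DifferentiableAt ℝ f y ∧ DifferentiableAt ℝ (fderiv ℝ f) y ∧
      DifferentiableAt ℝ (fderiv ℝ (fderiv ℝ f)) y := by
  have h0 : ContDiffAt ℝ 3 f y := hf.contDiffAt (hD.mem_nhds hy)
  have h1 : ContDiffAt ℝ 2 (fderiv ℝ f) y := h0.fderiv_right (by norm_num)
  have h2 : ContDiffAt ℝ 1 (fderiv ℝ (fderiv ℝ f)) y := h1.fderiv_right (by norm_num)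
  exact ⟨h0.differentiableAt (by norm_num), h1.differentiableAt (by norm_num),
    h2.differentiableAt (by norm_num)⟩

theorem ContDiffOn.fderiv_fderiv_symm (hD : IsOpen D) (hf : ContDiffOn ℝ 3 f D) {y : E}
    (hy : y ∈ D) (u v : E) : fderiv ℝ (fderiv ℝ f) y u v = fderiv ℝ (fderiv ℝ f) y v u := by
  have h0 : ContDiffAt ℝ 3 f y := hf.contDiffAt (hD.mem_nhds hy)
  exact h0.isSymmSndFDerivAt (by simp; norm_num) u v

theorem ContDiffOn.fderiv_fderiv_fderiv_symm_left (hD : IsOpen D) (hf : ContDiffOn ℝ 3 f D)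
    {y : E} (hy : y ∈ D) (u v w : E) :
    fderiv ℝ (fderiv ℝ (fderiv ℝ f)) y u v w = fderiv ℝ (fderiv ℝ (fderiv ℝ f)) y v u w := by
  have h0 : ContDiffAt ℝ 3 f y := hf.contDiffAt (hD.mem_nhds hy)
  have h1 : ContDiffAt ℝ 2 (fderiv ℝ f) y := h0.fderiv_right (by norm_num)
  rw [h1.isSymmSndFDerivAt (by simp) u v]

theorem hasDerivAt_fderiv_line (hD : IsOpen D) (hf : ContDiffOn ℝ 3 f D) {x d : E} {t : ℝ}
    (ht : x + t • d ∈ D) (w : E) :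
    HasDerivAt (fun s : ℝ => fderiv ℝ f (x + s • d) w)
      (fderiv ℝ (fderiv ℝ f) (x + t • d) d w) t :=
  (hasDerivAt_comp_line (hf.differentiableAt_fderiv_fderiv hD ht).2.1).clm_const_apply w

theorem hasDerivAt_fderiv_fderiv_line (hD : IsOpen D) (hf : ContDiffOn ℝ 3 f D) {x d : E} {t : ℝ}
    (ht : x + t • d ∈ D) (v w : E) :
    HasDerivAt (fun s : ℝ => fderiv ℝ (fderiv ℝ f) (x + s • d) v w)
      (fderiv ℝ (fderiv ℝ (fderiv ℝ f)) (x + t • d) d v w) t := by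
  have h := hasDerivAt_comp_line (E := E) (F := E →L[ℝ] E →L[ℝ] ℝ)
    (hf.differentiableAt_fderiv_fderiv hD ht).2.2
  have hv : HasDerivAt (fun s : ℝ => fderiv ℝ (fderiv ℝ f) (x + s • d) v)
      (fderiv ℝ (fderiv ℝ (fderiv ℝ f)) (x + t • d) d v) t :=
    HasDerivAt.clm_const_apply (F := E) (G := E →L[ℝ] ℝ) h v
  exact HasDerivAt.clm_const_apply (F := E) (G := ℝ) hv w

theorem ContDiffOn.fderiv_fderiv_fderiv_symm_right (hD : IsOpen D) (hf : ContDiffOn ℝ 3 f D)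
    {y : E} (hy : y ∈ D) (u v w : E) :
    fderiv ℝ (fderiv ℝ (fderiv ℝ f)) y u v w = fderiv ℝ (fderiv ℝ (fderiv ℝ f)) y u w v := by
  have hy' : y + (0 : ℝ) • u ∈ D := by simpa using hy
  have h1 := hasDerivAt_fderiv_fderiv_line hD hf hy' v w
  have h2 := hasDerivAt_fderiv_fderiv_line hD hf hy' w v
  have hev : ∀ᶠ s : ℝ in 𝓝 0, y + s • u ∈ D :=
    (by fun_prop : Continuous fun s : ℝ => y + s • u).continuousAt.eventually_mem
      (hD.mem_nhds hy')
  have h3 := h1.congr_of_eventuallyEq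
    (hev.mono fun s hs => hf.fderiv_fderiv_symm hD hs w v)
  simpa using h3.unique h2

theorem eventually_deriv_line (hD : IsOpen D) (hf : ContDiffOn ℝ 3 f D) {x v : E} {t : ℝ}
    (ht : x + t • v ∈ D) :
    deriv (fun s : ℝ => f (x + s • v)) =ᶠ[𝓝 t] (fun s => fderiv ℝ f (x + s • v) v) ∧
    deriv (deriv (fun s : ℝ => f (x + s • v))) =ᶠ[𝓝 t]
      (fun s => fderiv ℝ (fderiv ℝ f) (x + s • v) v v) := by
  have hev : ∀ᶠ s : ℝ in 𝓝 t, x + s • v ∈ D :=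
    (by fun_prop : Continuous fun s : ℝ => x + s • v).continuousAt.eventually_mem
      (hD.mem_nhds ht)
  have h1 : deriv (fun s : ℝ => f (x + s • v)) =ᶠ[𝓝 t]
      (fun s => fderiv ℝ f (x + s • v) v) := hev.mono fun s hs =>
    (hasDerivAt_comp_line (hf.differentiableAt_fderiv_fderiv hD hs).1).deriv
  refine ⟨h1, ?_⟩
  filter_upwards [h1.deriv, hev] with s hs hsD
  rw [hs, (hasDerivAt_fderiv_line hD hf hsD v).deriv]

theorem iteratedDeriv_two_line (hD : IsOpen D) (hf : ContDiffOn ℝ 3 f D) {x v : E} {t : ℝ}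
    (ht : x + t • v ∈ D) : iteratedDeriv 2 (fun s : ℝ => f (x + s • v)) t =
      fderiv ℝ (fderiv ℝ f) (x + t • v) v v := by
  rw [iteratedDeriv_succ, iteratedDeriv_one]
  exact (eventually_deriv_line hD hf ht).2.eq_of_nhds

theorem iteratedDeriv_three_line (hD : IsOpen D) (hf : ContDiffOn ℝ 3 f D) {x v : E} {t : ℝ}
    (ht : x + t • v ∈ D) : iteratedDeriv 3 (fun s : ℝ => f (x + s • v)) t =
      fderiv ℝ (fderiv ℝ (fderiv ℝ f)) (x + t • v) v v v := by
  rw [iteratedDeriv_succ, iteratedDeriv_succ, iteratedDeriv_one,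
    (eventually_deriv_line hD hf ht).2.deriv_eq]
  exact (hasDerivAt_fderiv_fderiv_line hD hf ht v v).deriv

theorem ConvexOn.fderiv_fderiv_nonneg (hc : ConvexOn ℝ D f) (hD : IsOpen D)
    (hf : ContDiffOn ℝ 3 f D) {y : E} (hy : y ∈ D) (v : E) :
    0 ≤ fderiv ℝ (fderiv ℝ f) y v v := by
  have hy' : y + (0 : ℝ) • v ∈ D := by simpa using hy
  let L : ℝ →ᵃ[ℝ] E := AffineMap.lineMap y (y + v)
  have hL (s : ℝ) : L s = y + s • v := by
    simp [L, AffineMap.lineMap_apply, add_comm]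
  have hcL : ConvexOn ℝ (L ⁻¹' D) (fun s => f (y + s • v)) := by
    have := hc.comp_affineMap L
    simpa only [Function.comp_def, hL] using this
  have hopen : IsOpen (L ⁻¹' D) := by
    have : L ⁻¹' D = (fun s : ℝ => y + s • v) ⁻¹' D := by ext s; simp [hL]
    rw [this]
    exact hD.preimage (by fun_prop)
  have hmem : (0 : ℝ) ∈ L ⁻¹' D := by simpa [hL] using hy
  have hmono := hcL.monotoneOn_deriv (fun s hs =>
    (hasDerivAt_comp_line (hf.differentiableAt_fderiv_fderiv hD (by simpa [hL] using hs)).1).differentiableAt)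
  have h2 := hmono.derivWithin_nonneg (x := 0)
  rw [derivWithin_of_isOpen hopen hmem, (eventually_deriv_line hD hf hy').2.eq_of_nhds] at h2
  simpa using h2

/-- Second-order error of the gradient of a self-concordant function along a step of local length
less than one, measured in the dual local norm at the end point. -/
theorem selfConcordant_gradient_error_le (hD : IsOpen D) (hc : ConvexOn ℝ D f)
    (hf : ContDiffOn ℝ 3 f D)
    (hsc : ∀ x ∈ D, ∀ v : E, ∀ t : ℝ, x + t • v ∈ D →
      |iteratedDeriv 3 (fun s : ℝ => f (x + s • v)) t| ≤
        2 * iteratedDeriv 2 (fun s : ℝ => f (x + s • v)) t ^ ((3 : ℝ) / 2))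
    {x d : E} (hx : x ∈ D) (hxd : x + d ∈ D) {l : ℝ}
    (hl : l = √(fderiv ℝ (fderiv ℝ f) x d d)) (hl1 : l < 1) (w : E) :
    fderiv ℝ f (x + d) w - fderiv ℝ f x w - fderiv ℝ (fderiv ℝ f) x d w ≤
      (l / (1 - l)) ^ 2 * √(fderiv ℝ (fderiv ℝ f) (x + d) w w) := by
  set B := fderiv ℝ (fderiv ℝ f) with hB
  set T := fderiv ℝ B with hT
  have hl0 : 0 ≤ l := hl ▸ Real.sqrt_nonneg _
  have hB0 {y} (hy : y ∈ D) (v) : 0 ≤ B y v v := hc.fderiv_fderiv_nonneg hD hf hy v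
  have hcube {y} (hy : y ∈ D) (u : E) : |T y u u u| ≤ 2 * √(B y u u) ^ 3 := by
    have hy' : y + (0 : ℝ) • u ∈ D := by simpa using hy
    have := hsc y hy u 0 hy'
    rw [iteratedDeriv_two_line hD hf hy', iteratedDeriv_three_line hD hf hy', zero_smul,
      add_zero] at this
    refine this.trans_eq ?_
    rw [Real.sqrt_eq_rpow, ← Real.rpow_natCast, ← Real.rpow_mul (hB0 hy u)]
    norm_num
    rfl
  have hpolar {y} (hy : y ∈ D) (u v : E) : T y u u v ≤ 2 * B y u u * √(B y v v) :=
    trilinear_polar_le (hf.fderiv_fderiv_symm hD hy) (hB0 hy) zero_le_two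
      (hf.fderiv_fderiv_fderiv_symm_left hD hy) (hf.fderiv_fderiv_fderiv_symm_right hD hy)
      (hcube hy) u v
  have hseg {t : ℝ} (ht : t ∈ Icc (0 : ℝ) 1) : x + t • d ∈ D :=
    hc.1.add_smul_mem hx hxd ht
  have hgrow {t : ℝ} (ht : t ∈ Icc (0 : ℝ) 1) : √(B (x + t • d) d d) ≤ l / (1 - t * l) :=
    sqrt_le_of_abs_deriv_le (fun t ht => hasDerivAt_fderiv_fderiv_line hD hf (hseg ht) d d)
      (fun t ht => hB0 (hseg ht) d) (fun t ht => hcube (hseg ht) d) (by simpa using hl) hl1 ht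
  have hback {t : ℝ} (ht : t ∈ Icc (0 : ℝ) 1) :
      √(B (x + t • d) w w) ≤ √(B (x + d) w w) * ((1 - t * l) / (1 - l)) := by
    have := sqrt_le_mul_of_abs_deriv_le (p := fun t => B (x + t • d) w w)
      (fun t ht => hasDerivAt_fderiv_fderiv_line hD hf (hseg ht) w w) hl0 hl1 (fun t ht => by
        have h1 := hpolar (hseg ht) w (-d)
        simp only [map_neg, _root_.neg_apply, neg_neg] at h1
        rw [hf.fderiv_fderiv_fderiv_symm_left hD (hseg ht) d w w,
          hf.fderiv_fderiv_fderiv_symm_right hD (hseg ht) w d w]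
        exact h1.trans (mul_le_mul_of_nonneg_left (hgrow ht)
          (mul_nonneg zero_le_two (hB0 (hseg ht) w)))) ht
    simpa using this
  have := taylor_two_le (C := (l / (1 - l)) ^ 2 * √(B (x + d) w w))
    (fun t ht => hasDerivAt_fderiv_line hD hf (hseg ht) w)
    (fun t ht => hasDerivAt_fderiv_fderiv_line hD hf (hseg ht) d w) (fun t ht => by
      have h1 := hgrow ht
      have h2 := hback ht
      have htl : 0 < 1 - t * l := by nlinarith [ht.1, ht.2]
      have htl' : 1 - t * l ≤ 1 := by nlinarith [ht.1]
      have hl2 : 0 < 1 - l := by linarith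
      have hdd : B (x + t • d) d d ≤ (l / (1 - t * l)) ^ 2 :=
        (Real.sqrt_le_left (by positivity)).1 h1
      have hle : 1 - l ≤ 1 - t * l := by nlinarith [ht.2]
      calc T (x + t • d) d d w ≤ 2 * B (x + t • d) d d * √(B (x + t • d) w w) :=
            hpolar (hseg ht) d w
        _ ≤ 2 * (l / (1 - t * l)) ^ 2 * (√(B (x + d) w w) * ((1 - t * l) / (1 - l))) := by
            gcongr
        _ = 2 * (l * (l / (1 - t * l)) / (1 - l) * √(B (x + d) w w)) := by
            field_simp
        _ ≤ 2 * (l * (l / (1 - l)) / (1 - l) * √(B (x + d) w w)) := by gcongr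
        _ = _ := by ring)
  simpa using this

end SelfConcordant

section ProximalNewton

theorem dotCLM_apply (v y : Fin n → ℝ) : dotCLM v y = v ⬝ᵥ y := rfl

/-- First-order optimality of a proximal point, as a subgradient inequality. -/
theorem IsProxPt.subgradient_le {H : Matrix (Fin n) (Fin n) ℝ} (hH : H.IsSymm)
    {g : (Fin n → ℝ) → EReal} (hg : EConvex g) {u p q : Fin n → ℝ} (hp : IsProxPt H g u p)
    {a b : ℝ} (ha : g p = a) (hb : g q = b) : a + (u - H.mulVec p) ⬝ᵥ (q - p) ≤ b := by
  set e := q - p with he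
  have hsymm : e ⬝ᵥ H.mulVec p = p ⬝ᵥ H.mulVec e := by
    rw [dotProduct_mulVec, dotProduct_comm, ← mulVec_transpose, hH.eq]
  have key : ∀ τ ∈ Ioo (0 : ℝ) 1,
      a + (u - H.mulVec p) ⬝ᵥ e - τ * (1 / 2 * (e ⬝ᵥ H.mulVec e)) ≤ b := by
    rintro τ ⟨hτ0, hτ1⟩
    have hz : (1 - τ) • p + τ • q = p + τ • e := by rw [he]; module
    have h1 := hg p q (1 - τ) τ (by linarith) hτ0.le (by ring)
    have h2 := hp (p + τ • e)
    rw [hz, ha, hb] at h1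
    have h3 : ((a + (1 / 2 * (p ⬝ᵥ H.mulVec p) - u ⬝ᵥ p) : ℝ) : EReal) ≤
        (((1 - τ) * a + τ * b + (1 / 2 * ((p + τ • e) ⬝ᵥ H.mulVec (p + τ • e))
          - u ⬝ᵥ (p + τ • e)) : ℝ) : EReal) := by
      refine le_trans (le_of_eq ?_) (h2.trans ((add_le_add_left h1 _).trans (le_of_eq ?_)))
      · rw [proxObj, ha]; norm_cast
      · norm_cast
    have h4 := EReal.coe_le_coe_iff.1 h3
    simp only [mulVec_add, mulVec_smul, dotProduct_add, add_dotProduct, dotProduct_smul,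
      smul_dotProduct, smul_eq_mul, hsymm] at h4
    have h5 : (H.mulVec p) ⬝ᵥ e = p ⬝ᵥ H.mulVec e := by rw [dotProduct_comm, hsymm]
    rw [sub_dotProduct, h5]
    refine le_of_mul_le_mul_left ?_ hτ0
    linarith
  refine le_of_tendsto (x := 𝓝[>] (0 : ℝ))
    (f := fun τ => a + (u - H.mulVec p) ⬝ᵥ e - τ * (1 / 2 * (e ⬝ᵥ H.mulVec e))) ?_
    (eventually_of_mem (Ioo_mem_nhdsGT one_pos) key)
  have hc : Continuous fun τ : ℝ =>
      a + (u - H.mulVec p) ⬝ᵥ e - τ * (1 / 2 * (e ⬝ᵥ H.mulVec e)) := by fun_prop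
  simpa using (hc.tendsto 0).mono_left nhdsWithin_le_nhds

variable {D : Set (Fin n → ℝ)} {f : (Fin n → ℝ) → ℝ} {f' : (Fin n → ℝ) → Fin n → ℝ}
  {f'' : (Fin n → ℝ) → Matrix (Fin n) (Fin n) ℝ}

theorem fderiv_fderiv_eq_of_gradient (hD : IsOpen D)
    (hgrad : ∀ x ∈ D, HasFDerivAt f (dotCLM (f' x)) x)
    (hhess : ∀ x ∈ D,
      HasFDerivAt f' (LinearMap.toContinuousLinearMap (f'' x).mulVecLin) x)
    {x : Fin n → ℝ} (hx : x ∈ D) (v w : Fin n → ℝ)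
    (hf2 : DifferentiableAt ℝ (fderiv ℝ f) x) :
    fderiv ℝ (fderiv ℝ f) x v w = (f'' x).mulVec v ⬝ᵥ w := by
  have h1 : HasFDerivAt (fun y => fderiv ℝ f y w)
      ((ContinuousLinearMap.apply ℝ ℝ w).comp (fderiv ℝ (fderiv ℝ f) x)) x :=
    (ContinuousLinearMap.apply ℝ ℝ w).hasFDerivAt.comp x hf2.hasFDerivAt
  have h2 : HasFDerivAt (fun y => dotCLM w (f' y))
      ((dotCLM w).comp (LinearMap.toContinuousLinearMap (f'' x).mulVecLin)) x :=
    (dotCLM w).hasFDerivAt.comp x (hhess x hx)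
  have heq : (fun y => fderiv ℝ f y w) =ᶠ[𝓝 x] fun y => dotCLM w (f' y) := by
    filter_upwards [hD.mem_nhds hx] with y hy
    rw [(hgrad y hy).fderiv, dotCLM_apply, dotCLM_apply, dotProduct_comm]
  have h3 := DFunLike.congr_fun (h1.unique (h2.congr_of_eventuallyEq heq)) v
  simp only [ContinuousLinearMap.comp_apply, ContinuousLinearMap.apply_apply] at h3
  rw [h3, dotCLM_apply, dotProduct_comm]
  rfl

/-- One full proximal-Newton step on a self-concordant function. -/
theorem proximalNewton_step_le (hf : StdSelfConcordantOn D f)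
    (hgrad : ∀ x ∈ D, HasFDerivAt f (dotCLM (f' x)) x)
    (hhess : ∀ x ∈ D,
      HasFDerivAt f' (LinearMap.toContinuousLinearMap (f'' x).mulVecLin) x)
    {g : (Fin n → ℝ) → EReal} (hg_proper : EProper g) (hg_conv : EConvex g)
    {x d e : Fin n → ℝ} (hx : x ∈ D) (hxd : x + d ∈ D)
    (hgxd : g (x + d) ≠ ⊤) (hgxde : g (x + d + e) ≠ ⊤)
    (hpd : (f'' x).PosDef) (hpd' : (f'' (x + d)).PosDef)
    (hprox : IsProxPt (f'' x) g ((f'' x).mulVec x - f' x) (x + d))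
    (hprox' : IsProxPt (f'' (x + d)) g ((f'' (x + d)).mulVec (x + d) - f' (x + d)) (x + d + e))
    (hlt : mNorm (f'' x) d < 1) :
    mNorm (f'' (x + d)) e ≤ (mNorm (f'' x) d / (1 - mNorm (f'' x) d)) ^ 2 := by
  obtain ⟨hD, -, hc, hC3, hsc⟩ := hf
  have hsymm {H : Matrix (Fin n) (Fin n) ℝ} (h : H.PosDef) : H.IsSymm := by
    have := h.1
    rwa [IsHermitian, conjTranspose_eq_transpose_of_trivial] at this
  have hB {y} (hy : y ∈ D) (v w : Fin n → ℝ) :=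
    fderiv_fderiv_eq_of_gradient hD hgrad hhess hy v w
      (hC3.differentiableAt_fderiv_fderiv hD hy).2.1
  have hnorm {y} (hy : y ∈ D) (v : Fin n → ℝ) :
      mNorm (f'' y) v = √(fderiv ℝ (fderiv ℝ f) y v v) := by
    rw [mNorm, hB hy, dotProduct_comm]
  set l := mNorm (f'' x) d
  have herr := selfConcordant_gradient_error_le hD hc hC3 hsc hx hxd (hnorm hx d) hlt (-e)
  have hneg : fderiv ℝ (fderiv ℝ f) (x + d) (-e) (-e) = fderiv ℝ (fderiv ℝ f) (x + d) e e := by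
    simp
  rw [hneg, ← hnorm hxd, (hgrad _ hxd).fderiv, (hgrad _ hx).fderiv, hB hx, dotCLM_apply,
    dotCLM_apply] at herr
  have ha := EReal.coe_toReal hgxd (hg_proper.1 _)
  have hb := EReal.coe_toReal hgxde (hg_proper.1 _)
  have h1 := hprox.subgradient_le (hsymm hpd) hg_conv ha.symm hb.symm
  have h2 := hprox'.subgradient_le (hsymm hpd') hg_conv hb.symm ha.symm
  have e1 : x + d + e - (x + d) = e := by abel
  have e2 : x + d - (x + d + e) = -e := by abel
  have h0 : 0 ≤ e ⬝ᵥ (f'' (x + d)).mulVec e := by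
    rw [dotProduct_comm, ← hB hxd]
    exact hc.fderiv_fderiv_nonneg hD hC3 hxd e
  have hsq : mNorm (f'' (x + d)) e ^ 2 = (f'' (x + d)).mulVec e ⬝ᵥ e := by
    rw [mNorm, Real.sq_sqrt h0, dotProduct_comm]
  rw [e1] at h1
  rw [e2] at h2
  simp only [mulVec_add, sub_dotProduct, add_dotProduct, dotProduct_neg] at h1 h2 herr
  have hN : 0 ≤ mNorm (f'' (x + d)) e := Real.sqrt_nonneg _
  rcases hN.eq_or_lt with hN | hN
  · rw [← hN]; positivity
  · refine le_of_mul_le_mul_right ?_ hN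
    rw [← sq, hsq]
    linarith

end ProximalNewton

theorem proximalNewton_rate_bounds {l m : ℝ} (h0 : 0 ≤ l) (hl : l ≤ (5 - √17) / 4)
    (hm : m ≤ (l / (1 - l)) ^ 2) :
    m ≤ l ^ 2 / (1 - 4 * l + 2 * l ^ 2) ∧ m ≤ l / 2 ∧ m ≤ 2 * l ^ 2 := by
  have hs : (4.1 : ℝ) ≤ √17 := Real.le_sqrt_of_sq_le (by norm_num)
  have hl' : l ≤ 9 / 40 := by linarith
  have hden : 0 < 1 - 4 * l + 2 * l ^ 2 := by nlinarith
  have h1 : 0 < 1 - l := by linarith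
  have h2 : m ≤ 2 * l ^ 2 := by
    refine hm.trans ?_
    rw [div_pow, div_le_iff₀ (by positivity)]
    nlinarith [mul_nonneg (sq_nonneg l) (by nlinarith : 0 ≤ 2 * (1 - l) ^ 2 - 1)]
  refine ⟨hm.trans ?_, by nlinarith, h2⟩
  rw [div_pow]
  gcongr
  nlinarith

/-- For the full-step proximal-Newton scheme, if `λ₀ ≤ σ̄ := (5 − √17)/4`
then `λ_{k+1} ≤ λ_k²/(1 − 4λ_k + 2λ_k²)`, `λ_{k+1} ≤ λ_k`, and `λ_k → 0` at a quadratic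
rate. -/
theorem full_newton_quadratic_convergence
    (n : ℕ) (D : Set (Fin n → ℝ)) (f : (Fin n → ℝ) → ℝ)
    (f' : (Fin n → ℝ) → Fin n → ℝ)
    (f'' : (Fin n → ℝ) → Matrix (Fin n) (Fin n) ℝ)
    (hf : StdSelfConcordantOn D f)
    (hgrad : ∀ x ∈ D, HasFDerivAt f (dotCLM (f' x)) x)
    (hhess : ∀ x ∈ D,
      HasFDerivAt f' (LinearMap.toContinuousLinearMap (f'' x).mulVecLin) x)
    (g : (Fin n → ℝ) → EReal) (hg_proper : EProper g)
    (hg_lsc : LowerSemicontinuous g) (hg_conv : EConvex g)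
    (x d : ℕ → Fin n → ℝ) (lam : ℕ → ℝ)
    (hdom : ∀ k, x k ∈ D ∧ g (x k) ≠ ⊤)
    (hpd : ∀ k, (f'' (x k)).PosDef)
    (hprox : ∀ k,
      IsProxPt (f'' (x k)) g ((f'' (x k)).mulVec (x k) - f' (x k)) (x k + d k))
    (hlam : ∀ k, lam k = mNorm (f'' (x k)) (d k))
    (hupd : ∀ k, x (k + 1) = x k + d k)
    (xs : Fin n → ℝ) (hxsD : xs ∈ D) (hxsg : g xs ≠ ⊤)
    (hxs_min : ∀ y, Fext D f g xs ≤ Fext D f g y)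
    (hxs_uniq : ∀ y, (∀ z, Fext D f g y ≤ Fext D f g z) → y = xs)
    (hxs_pd : (f'' xs).PosDef)
    (hlam0 : lam 0 ≤ (5 - Real.sqrt 17) / 4) :
    (∀ k, lam (k + 1) ≤ lam k ^ 2 / (1 - 4 * lam k + 2 * lam k ^ 2)) ∧
      (∀ k, lam (k + 1) ≤ lam k) ∧
      (∃ c : ℝ, 0 < c ∧ ∀ k, lam (k + 1) ≤ c * lam k ^ 2) ∧
      Tendsto lam atTop (𝓝 0) := by
  have hpos : ∀ k, 0 ≤ lam k := fun k => hlam k ▸ Real.sqrt_nonneg _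
  have hs : (4.1 : ℝ) ≤ √17 := Real.le_sqrt_of_sq_le (by norm_num)
  have hstep : ∀ k, lam k ≤ (5 - √17) / 4 → lam (k + 1) ≤ (lam k / (1 - lam k)) ^ 2 := by
    intro k hk
    have hlt : lam k < 1 := by linarith
    have h1 := hdom (k + 1)
    have h2 := (hdom (k + 1 + 1)).2
    have h3 := hpd (k + 1)
    have h4 := hprox (k + 1)
    rw [hupd (k + 1)] at h2
    rw [hlam k] at hlt ⊢
    rw [hlam (k + 1)]
    rw [hupd k] at h1 h2 h3 h4 ⊢
    exact proximalNewton_step_le hf hgrad hhess hg_proper hg_conv (hdom k).1 h1.1 h1.2 h2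
      (hpd k) h3 (hprox k) h4 hlt
  have hsmall : ∀ k, lam k ≤ (5 - √17) / 4 := by
    intro k
    induction k with
    | zero => exact hlam0
    | succ k ih =>
      linarith [(proximalNewton_rate_bounds (hpos k) ih (hstep k ih)).2.1, hpos k]
  have hrate := fun k => proximalNewton_rate_bounds (hpos k) (hsmall k) (hstep k (hsmall k))
  refine ⟨fun k => (hrate k).1, fun k => by linarith [(hrate k).2.1, hpos k],
    ⟨2, two_pos, fun k => (hrate k).2.2⟩, ?_⟩
  have hgeom : ∀ k, lam k ≤ lam 0 * (1 / 2) ^ k := by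
    intro k
    induction k with
    | zero => simp
    | succ k ih =>
      rw [pow_succ]
      linarith [(hrate k).2.1]
  refine squeeze_zero hpos hgeom ?_
  simpa using (tendsto_pow_atTop_nhds_zero_of_lt_one (by norm_num : (0 : ℝ) ≤ 1 / 2)
    (by norm_num)).const_mul (lam 0)
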